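/- arXiv:2204.09002 — 6 statements merged into one kernel-verified Lean document; each statement's English description precedes it below -/
import Mathlib

section
/- Let n ≥ 2 be an integer, α ∈ (0,1/2) real, σ = (1-2α)/(1+α(n-2)) and A = σ^((α-1)/(1+α(n-2))) (1-σ)^(α/(1+α(n-2))). Then the function f(l) = A l^σ satisfies f''(l) + (f'(l))^(1/α) · f(l)^(n-1) = 0 for all l > 0. -/
/-- With `σ = (1-2α)/(1+α(n-2))` and
`A = σ^((α-1)/(1+α(n-2))) (1-σ)^(α/(1+α(n-2)))`, the function `f(l) = A l^σ`
satisfies `f''(l) + (f'(l))^(1/α) · f(l)^(n-1) = 0` for all `l > 0`. -/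
theorem stmt2 (n : ℕ) (hn : 2 ≤ n) (α : ℝ) (hα0 : 0 < α) (hα2 : α < 1/2)
    (σ A : ℝ) (hσ : σ = (1 - 2*α) / (1 + α*((n : ℝ) - 2)))
    (hA : A = σ ^ ((α - 1)/(1 + α*((n : ℝ) - 2))) * (1 - σ) ^ (α/(1 + α*((n : ℝ) - 2))))
    (f : ℝ → ℝ) (hf : ∀ l : ℝ, f l = A * l ^ σ) :
    ∀ l : ℝ, 0 < l →
      deriv (deriv f) l + (deriv f l) ^ (1/α) * (f l) ^ ((n : ℝ) - 1) = 0 := by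
  intro l hl
  have hn2 : (2 : ℝ) ≤ n := by exact_mod_cast hn
  have hD : 0 < 1 + α * ((n : ℝ) - 2) := by nlinarith
  have hσ0 : 0 < σ := by rw [hσ]; exact div_pos (by linarith) hD
  have hσD : σ * (1 + α * ((n : ℝ) - 2)) = 1 - 2 * α := by
    rw [hσ]; exact div_mul_cancel₀ _ hD.ne'
  have hσ1 : 0 < 1 - σ := by
    have : 0 < (1 - σ) * (1 + α * ((n : ℝ) - 2)) := by nlinarith
    exact pos_of_mul_pos_left this hD.le
  have hA0 : 0 < A := by rw [hA]; positivity
  have hlogA : Real.log A * (1 + α * ((n : ℝ) - 2))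
      = (α - 1) * Real.log σ + α * Real.log (1 - σ) := by
    rw [hA, Real.log_mul (by positivity) (by positivity), Real.log_rpow hσ0, Real.log_rpow hσ1]
    field_simp
  have hf_eq : f = fun x => A * x ^ σ := funext hf
  have hderiv : ∀ x : ℝ, 0 < x → deriv f x = A * σ * x ^ (σ - 1) := fun x hx => by
    rw [hf_eq, ((Real.hasDerivAt_rpow_const (p := σ) (Or.inl hx.ne')).const_mul A).deriv, mul_assoc]
  have hderiv2 : deriv (deriv f) l = -(A * σ * (1 - σ) * l ^ (σ - 2)) := by
    have hev : deriv f =ᶠ[nhds l] fun x => A * σ * x ^ (σ - 1) := by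
      filter_upwards [lt_mem_nhds hl] with x hx using hderiv x hx
    rw [hev.deriv_eq,
      ((Real.hasDerivAt_rpow_const (p := σ - 1) (Or.inl hl.ne')).const_mul (A * σ)).deriv,
      show σ - 1 - 1 = σ - 2 by ring]
    ring
  have key : (A * σ * l ^ (σ - 1)) ^ (1 / α) * (A * l ^ σ) ^ ((n : ℝ) - 1)
      = A * σ * (1 - σ) * l ^ (σ - 2) := by
    apply Real.log_injOn_pos (Set.mem_Ioi.2 (by positivity)) (Set.mem_Ioi.2 (by positivity))
    rw [Real.log_mul (by positivity) (by positivity), Real.log_rpow (by positivity),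
      Real.log_rpow (by positivity), Real.log_mul (by positivity) (by positivity),
      Real.log_mul hA0.ne' hσ0.ne', Real.log_mul hA0.ne' (by positivity),
      Real.log_mul (by positivity) (by positivity), Real.log_mul (by positivity) hσ1.ne',
      Real.log_mul hA0.ne' hσ0.ne', Real.log_rpow hl, Real.log_rpow hl, Real.log_rpow hl]
    field_simp
    linear_combination hlogA + Real.log l * hσD
  rw [hderiv2, hderiv l hl, hf l, key]
  ring
end

section
/- Let α ∈ (0,1/2), let h: ℝ → ℝ be a shrinker support function on the circle, and set σ = 1-2α and A = σ^(α-1) (1-σ)^α. Then the function S(l,θ) = A l^σ h(θ) satisfies the blow-down translator equation ∂²S/∂l²(l,θ) + (∂S/∂l(l,θ))^(1/α) · (∂²S/∂θ²(l,θ) + S(l,θ)) = 0 for all l > 0 and all θ ∈ ℝ. -/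
/-- For `α ∈ (0,1/2)` and a shrinker support function `h` on the
circle (smooth, `2π`-periodic, positive, with `h'' + h = h^(1-1/α)`), setting
`σ = 1-2α`, `A = σ^(α-1)(1-σ)^α`, the function `S(l,θ) = A l^σ h(θ)` satisfies
the blow-down translator equation
`∂²S/∂l² + (∂S/∂l)^(1/α) (∂²S/∂θ² + S) = 0` for all `l > 0` and `θ ∈ ℝ`. -/
theorem stmt3 (α : ℝ) (hα0 : 0 < α) (hα2 : α < 1/2)
    (h : ℝ → ℝ) (hsm : ContDiff ℝ (⊤ : ℕ∞) h) (hper : Function.Periodic h (2*Real.pi))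
    (hpos : ∀ θ, 0 < h θ)
    (hshr : ∀ θ, deriv (deriv h) θ + h θ = h θ ^ (1 - 1/α))
    (σ A : ℝ) (hσ : σ = 1 - 2*α) (hA : A = σ ^ (α - 1) * (1 - σ) ^ α)
    (S : ℝ → ℝ → ℝ) (hS : ∀ l θ : ℝ, S l θ = A * l ^ σ * h θ) :
    ∀ l : ℝ, 0 < l → ∀ θ : ℝ,
      deriv (deriv (fun l' => S l' θ)) l
        + (deriv (fun l' => S l' θ) l) ^ (1/α)
          * (deriv (deriv (fun θ' => S l θ')) θ + S l θ) = 0 := by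
  intro l hl θ
  have hσ0 : 0 < σ := by linarith
  have hσ1 : 0 < 1 - σ := by linarith
  have hα : α ≠ 0 := hα0.ne'
  have hAσ : A * σ = (σ * (1 - σ)) ^ α := by
    rw [hA, Real.mul_rpow hσ0.le hσ1.le, Real.rpow_sub_one hσ0.ne']
    field_simp
  have hd : ∀ x : ℝ, 0 < x →
      deriv (fun l' => S l' θ) x = A * σ * x ^ (σ - 1) * h θ := by
    intro x hx
    simp only [hS]
    have H := ((Real.hasDerivAt_rpow_const (p := σ) (Or.inl hx.ne')).const_mul A).mul_const (h θ)
    rw [H.deriv]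
    ring
  have hdd : deriv (deriv (fun l' => S l' θ)) l
      = A * σ * (σ - 1) * l ^ (σ - 2) * h θ := by
    have hev : deriv (fun l' => S l' θ) =ᶠ[nhds l]
        fun x => A * σ * x ^ (σ - 1) * h θ := by
      filter_upwards [lt_mem_nhds hl] with x hx using hd x hx
    have H := ((Real.hasDerivAt_rpow_const (p := σ - 1) (Or.inl hl.ne')).const_mul
      (A * σ)).mul_const (h θ)
    rw [hev.deriv_eq, H.deriv, show σ - 1 - 1 = σ - 2 by ring]
    ring
  have hθ : deriv (deriv (fun θ' => S l θ')) θ + S l θ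
      = A * l ^ σ * h θ ^ (1 - 1/α) := by
    have hfun : deriv (fun θ' => S l θ') = fun θ' => A * l ^ σ * deriv h θ' := by
      funext x
      simp only [hS, deriv_const_mul_field]
    rw [hfun, deriv_const_mul_field, hS, ← hshr θ]
    ring
  have hpow : (A * σ * l ^ (σ - 1) * h θ) ^ (1/α)
      = σ * (1 - σ) * l ^ (-2 : ℝ) * h θ ^ (1/α) := by
    have hp : 0 < σ * (1 - σ) := mul_pos hσ0 hσ1
    have hexp : (σ - 1) * (1/α) = -2 := by
      rw [hσ]
      field_simp
      ring
    rw [hAσ, Real.mul_rpow (by positivity) (hpos θ).le,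
      Real.mul_rpow (by positivity) (by positivity), ← Real.rpow_mul hp.le,
      ← Real.rpow_mul hl.le, hexp, mul_one_div_cancel hα, Real.rpow_one]
  have hlp : l ^ (-2 : ℝ) * l ^ σ = l ^ (σ - 2) := by
    rw [← Real.rpow_add hl]
    congr 1
    ring
  have hhp : h θ ^ (1/α) * h θ ^ (1 - 1/α) = h θ := by
    rw [← Real.rpow_add (hpos θ), add_sub_cancel, Real.rpow_one]
  rw [hdd, hd l hl, hθ, hpow]
  linear_combination A * σ * (1 - σ) * (h θ ^ (1/α) * h θ ^ (1 - 1/α)) * hlp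
    + A * σ * (1 - σ) * l ^ (σ - 2) * hhp
end

section
/- Let β⁻ < β⁺ < γ be real numbers, R ∈ ℝ, K ≥ 0, and let g: [R,∞) → ℝ be continuous with |g(s)| ≤ K e^(γs) for all s ≥ R. Define w(s) = e^(β⁻ s) ∫_R^s e^((β⁺-β⁻)r) ( ∫_R^r e^(-β⁺ t) g(t) dt ) dr for s ≥ R. Then w is twice continuously differentiable on (R,∞), w(R) = 0, w''(s) - (β⁺+β⁻) w'(s) + β⁺β⁻ w(s) = g(s) for all s > R, and |w(s)| ≤ K e^(γs) / ((γ-β⁺)(γ-β⁻)) for all s ≥ R. -/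
open MeasureTheory intervalIntegral

/-- The growing-mode solution formula
`w(s) = e^(β⁻ s) ∫_R^s e^((β⁺-β⁻)r) ( ∫_R^r e^(-β⁺ t) g(t) dt ) dr`. -/
noncomputable def wGrow (bp bm R : ℝ) (g : ℝ → ℝ) : ℝ → ℝ := fun s =>
  Real.exp (bm*s) *
    ∫ r in R..s, Real.exp ((bp - bm)*r) * ∫ t in R..r, Real.exp (-bp*t) * g t

/-- The formula `wGrow` only sees the values of `g` on `[R, ∞)`. -/
theorem wGrow_congr {bp bm R : ℝ} {f g : ℝ → ℝ} (h : Set.EqOn f g (Set.Ici R)) :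
    Set.EqOn (wGrow bp bm R f) (wGrow bp bm R g) (Set.Ici R) := by
  intro s hs
  unfold wGrow
  congr 1
  refine integral_congr fun r hr => ?_
  rw [Set.uIcc_of_le hs] at hr
  congr 1
  refine integral_congr fun t ht => ?_
  rw [Set.uIcc_of_le hr.1] at ht
  rw [h ht.1]

/-- For continuous `g`, `w = wGrow` satisfies the first-order equation
`w' = β⁻ w + e^(β⁺ s) ∫_R^s e^(-β⁺ t) g(t) dt`. -/
theorem hasDerivAt_wGrow {g : ℝ → ℝ} (hg : Continuous g) (bp bm R s : ℝ) :
    HasDerivAt (wGrow bp bm R g)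
      (bm * wGrow bp bm R g s
        + Real.exp (bp * s) * ∫ t in R..s, Real.exp (-bp * t) * g t) s := by
  have hI : Continuous fun r => ∫ t in R..r, Real.exp (-bp * t) * g t :=
    continuous_primitive (fun a b => (by fun_prop : Continuous _).intervalIntegrable a b) R
  have hJ := (by fun_prop : Continuous fun r => Real.exp ((bp - bm) * r) *
    ∫ t in R..r, Real.exp (-bp * t) * g t).integral_hasStrictDerivAt R s |>.hasDerivAt
  have he := ((hasDerivAt_id s).const_mul bm).exp
  refine (he.mul hJ).congr_deriv ?_
  have hexp : Real.exp (bp * s) = Real.exp (bm * s) * Real.exp ((bp - bm) * s) := by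
    rw [← Real.exp_add]; ring_nf
  simp only [wGrow, hexp, id]
  ring

theorem hasDerivAt_exp_mul_integral_exp_neg_mul {g : ℝ → ℝ} (hg : Continuous g) (b R s : ℝ) :
    HasDerivAt (fun s => Real.exp (b * s) * ∫ t in R..s, Real.exp (-b * t) * g t)
      (b * (Real.exp (b * s) * ∫ t in R..s, Real.exp (-b * t) * g t) + g s) s := by
  have hI := (by fun_prop : Continuous fun t => Real.exp (-b * t) * g t).integral_hasStrictDerivAt
    R s |>.hasDerivAt
  have he := ((hasDerivAt_id s).const_mul b).exp
  refine (he.mul hI).congr_deriv ?_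
  have hexp : Real.exp (b * s) * Real.exp (-b * s) = 1 := by
    rw [← Real.exp_add]; simp
  simp only [id]
  linear_combination g s * hexp

theorem deriv_wGrow {g : ℝ → ℝ} (hg : Continuous g) (bp bm R : ℝ) :
    deriv (wGrow bp bm R g) = fun s => bm * wGrow bp bm R g s
      + Real.exp (bp * s) * ∫ t in R..s, Real.exp (-bp * t) * g t :=
  funext fun s => (hasDerivAt_wGrow hg bp bm R s).deriv

theorem deriv_deriv_wGrow {g : ℝ → ℝ} (hg : Continuous g) (bp bm R : ℝ) :
    deriv (deriv (wGrow bp bm R g)) = fun s =>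
      (bp + bm) * deriv (wGrow bp bm R g) s - bp * bm * wGrow bp bm R g s + g s := by
  funext s
  rw [deriv_wGrow hg]
  refine (((hasDerivAt_wGrow hg bp bm R s).const_mul bm).add
    (hasDerivAt_exp_mul_integral_exp_neg_mul hg bp R s)).deriv.trans ?_
  ring

theorem contDiff_two_wGrow {g : ℝ → ℝ} (hg : Continuous g) (bp bm R : ℝ) :
    ContDiff ℝ 2 (wGrow bp bm R g) := by
  have hd : Differentiable ℝ (wGrow bp bm R g) :=
    fun s => (hasDerivAt_wGrow hg bp bm R s).differentiableAt
  have hd' : Differentiable ℝ (deriv (wGrow bp bm R g)) := by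
    rw [deriv_wGrow hg]
    exact (hd.const_mul bm).add fun s =>
      (hasDerivAt_exp_mul_integral_exp_neg_mul hg bp R s).differentiableAt
  rw [show (2 : WithTop ℕ∞) = 1 + 1 by norm_num, contDiff_succ_iff_deriv]
  refine ⟨hd, by simp, contDiff_one_iff_deriv.2 ⟨hd', ?_⟩⟩
  rw [deriv_deriv_wGrow hg]
  have := hd.continuous
  have := hd'.continuous
  fun_prop

/-- An exponential bound with positive rate is inherited by the primitive. -/
theorem abs_integral_le_of_abs_le_mul_exp {f : ℝ → ℝ} {a C R r : ℝ} (ha : 0 < a) (hC : 0 ≤ C)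
    (hr : R ≤ r) (hf : ∀ t, R ≤ t → |f t| ≤ C * Real.exp (a * t)) :
    |∫ t in R..r, f t| ≤ C / a * Real.exp (a * r) := by
  rw [← Real.norm_eq_abs]
  calc ‖∫ t in R..r, f t‖ ≤ ∫ t in R..r, C * Real.exp (a * t) :=
        norm_integral_le_of_norm_le hr
          (Filter.Eventually.of_forall fun t ht => hf t ht.1.le)
          ((by fun_prop : Continuous fun t => C * Real.exp (a * t)).intervalIntegrable R r)
    _ = C / a * (Real.exp (a * r) - Real.exp (a * R)) := by
        rw [intervalIntegral.integral_const_mul,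
          intervalIntegral.integral_comp_mul_left (fun x => Real.exp x) ha.ne', integral_exp,
          smul_eq_mul]
        ring
    _ ≤ C / a * Real.exp (a * r) := by
        gcongr
        exact sub_le_self _ (Real.exp_pos _).le

theorem abs_wGrow_le {bp bm γ R K : ℝ} {g : ℝ → ℝ} (h1 : bm < bp) (h2 : bp < γ) (hK : 0 ≤ K)
    (hgb : ∀ s, R ≤ s → |g s| ≤ K * Real.exp (γ * s)) {s : ℝ} (hs : R ≤ s) :
    |wGrow bp bm R g s| ≤ K * Real.exp (γ * s) / ((γ - bp) * (γ - bm)) := by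
  have hp : 0 < γ - bp := sub_pos.2 h2
  have hm : 0 < γ - bm := sub_pos.2 (h1.trans h2)
  have inner : ∀ r, R ≤ r → |∫ t in R..r, Real.exp (-bp * t) * g t| ≤
      K / (γ - bp) * Real.exp ((γ - bp) * r) := fun r hr =>
    abs_integral_le_of_abs_le_mul_exp hp hK hr fun t ht => by
      rw [abs_mul, Real.abs_exp]
      calc _ ≤ Real.exp (-bp * t) * (K * Real.exp (γ * t)) := by gcongr; exact hgb t ht
        _ = K * Real.exp ((γ - bp) * t) := by
          rw [mul_left_comm, ← Real.exp_add]; ring_nf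
  have outer : |∫ r in R..s, Real.exp ((bp - bm) * r) * ∫ t in R..r, Real.exp (-bp * t) * g t| ≤
      K / (γ - bp) / (γ - bm) * Real.exp ((γ - bm) * s) :=
    abs_integral_le_of_abs_le_mul_exp hm (by positivity) hs fun r hr => by
      rw [abs_mul, Real.abs_exp]
      calc _ ≤ Real.exp ((bp - bm) * r) * (K / (γ - bp) * Real.exp ((γ - bp) * r)) := by
            gcongr; exact inner r hr
        _ = K / (γ - bp) * Real.exp ((γ - bm) * r) := by
          rw [mul_left_comm, ← Real.exp_add]; ring_nf
  rw [wGrow, abs_mul, Real.abs_exp]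
  calc _ ≤ Real.exp (bm * s) * (K / (γ - bp) / (γ - bm) * Real.exp ((γ - bm) * s)) := by gcongr
    _ = K / (γ - bp) / (γ - bm) * Real.exp (γ * s) := by
      rw [mul_left_comm, ← Real.exp_add]; ring_nf
    _ = _ := by field_simp

/-- For `β⁻ < β⁺ < γ`, `K ≥ 0`, and continuous `g` on `[R,∞)` with
`|g(s)| ≤ K e^(γs)`, the function `w = wGrow` is C² on `(R,∞)`, vanishes at `R`,
solves `w'' - (β⁺+β⁻)w' + β⁺β⁻ w = g` on `(R,∞)`, and satisfies
`|w(s)| ≤ K e^(γs)/((γ-β⁺)(γ-β⁻))` on `[R,∞)`. -/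
theorem stmt8 (bp bm γ R K : ℝ) (h1 : bm < bp) (h2 : bp < γ) (hK : 0 ≤ K)
    (g : ℝ → ℝ) (hgc : ContinuousOn g (Set.Ici R))
    (hgb : ∀ s, R ≤ s → |g s| ≤ K * Real.exp (γ*s)) :
    ContDiffOn ℝ 2 (wGrow bp bm R g) (Set.Ioi R) ∧
    wGrow bp bm R g R = 0 ∧
    (∀ s, R < s →
      deriv (deriv (wGrow bp bm R g)) s
        - (bp + bm) * deriv (wGrow bp bm R g) s
        + bp*bm * wGrow bp bm R g s = g s) ∧
    (∀ s, R ≤ s → |wGrow bp bm R g s| ≤ K * Real.exp (γ*s) / ((γ - bp)*(γ - bm))) := by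
  obtain ⟨G, hG, hGg⟩ : ∃ G : ℝ → ℝ, Continuous G ∧ Set.EqOn g G (Set.Ici R) :=
    ⟨fun t => g (max R t), hgc.comp_continuous (by fun_prop) fun t => le_max_left R t,
      fun t ht => by simp only [max_eq_right (Set.mem_Ici.1 ht)]⟩
  have hw : Set.EqOn (wGrow bp bm R g) (wGrow bp bm R G) (Set.Ioi R) :=
    (wGrow_congr hGg).mono Set.Ioi_subset_Ici_self
  refine ⟨(contDiff_two_wGrow hG bp bm R).contDiffOn.congr hw, by simp [wGrow],
    fun s hs => ?_, fun s hs => abs_wGrow_le h1 h2 hK hgb hs⟩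
  have hev := hw.eventuallyEq_of_mem (Ioi_mem_nhds hs)
  rw [hev.deriv.deriv_eq, hev.deriv_eq, hev.eq_of_nhds, hGg (Set.mem_Ici.2 hs.le),
    deriv_deriv_wGrow hG]
  ring
end

section
/- Let n ≥ 2 and ℓ ≥ 2 be integers, α ∈ (0,1/2), and set λ = (n-1) - ℓ(ℓ+n-2) (so λ < 0 and c² - 4σ(1-σ)λ > 0). Then β⁺(λ) < σ if and only if α < 1/(ℓ² + (n-2)ℓ - (n-2)). -/
/-- `β⁺(λ) = (-c + √(c²-4σ(1-σ)λ))/2`. -/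
noncomputable def betaP (c σ lam : ℝ) : ℝ :=
  (-c + Real.sqrt (c^2 - 4*σ*(1 - σ)*lam)) / 2

/-- For integers `n ≥ 2`, `ℓ ≥ 2`, `α ∈ (0,1/2)`, and
`λ = (n-1) - ℓ(ℓ+n-2)` (so `λ < 0` and `c² - 4σ(1-σ)λ > 0`), one has
`β⁺(λ) < σ` if and only if `α < 1/(ℓ² + (n-2)ℓ - (n-2))`. -/
theorem stmt9 (n ℓ : ℕ) (hn : 2 ≤ n) (hℓ : 2 ≤ ℓ)
    (α : ℝ) (hα0 : 0 < α) (hα2 : α < 1/2)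
    (σ c lam : ℝ)
    (hσ : σ = (1 - 2*α) / (1 + α*((n : ℝ) - 2)))
    (hc : c = (((n : ℝ) - 1) - α*((n : ℝ) - 2)) / (1 + α*((n : ℝ) - 2)))
    (hlam : lam = ((n : ℝ) - 1) - (ℓ : ℝ)*((ℓ : ℝ) + (n : ℝ) - 2)) :
    lam < 0 ∧ 0 < c^2 - 4*σ*(1 - σ)*lam ∧
    (betaP c σ lam < σ ↔ α < 1/((ℓ : ℝ)^2 + ((n : ℝ) - 2)*(ℓ : ℝ) - ((n : ℝ) - 2))) := by
  have hm : (0 : ℝ) ≤ (n : ℝ) - 2 := by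
    have : (2 : ℝ) ≤ n := by exact_mod_cast hn
    linarith
  have hℓ' : (2 : ℝ) ≤ ℓ := by exact_mod_cast hℓ
  have hD : 0 < 1 + α * ((n : ℝ) - 2) := by positivity
  have hσ0 : 0 < σ := by
    rw [hσ]
    exact div_pos (by linarith) hD
  have hσ1 : 1 - σ = α * n / (1 + α * ((n : ℝ) - 2)) := by
    rw [hσ]
    field_simp
    ring
  have hσ1' : 0 < 1 - σ := by
    rw [hσ1]
    exact div_pos (mul_pos hα0 (by linarith)) hD
  have hc0 : 0 < c := by
    rw [hc]
    exact div_pos (by nlinarith) hD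
  have hlam0 : lam < 0 := by
    rw [hlam]
    nlinarith
  have hprod : σ * (1 - σ) * lam < 0 := mul_neg_of_pos_of_neg (mul_pos hσ0 hσ1') hlam0
  refine ⟨hlam0, by nlinarith [sq_nonneg c], ?_⟩
  have hden : (ℓ : ℝ)^2 + ((n : ℝ) - 2) * ℓ - ((n : ℝ) - 2) = 1 - lam := by
    rw [hlam]
    ring
  have hgap : σ + c + (1 - σ) * lam = n / (1 + α * ((n : ℝ) - 2)) * (1 - α * (1 - lam)) := by
    rw [hσ1, hσ, hc]
    field_simp
    ring
  have hn0 : 0 < (n : ℝ) / (1 + α * ((n : ℝ) - 2)) := div_pos (by linarith) hD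
  calc
    betaP c σ lam < σ ↔ √(c^2 - 4*σ*(1 - σ)*lam) < 2 * σ + c := by
      unfold betaP
      constructor <;> intro h <;> linarith
    _ ↔ c^2 - 4*σ*(1 - σ)*lam < (2 * σ + c)^2 := Real.sqrt_lt' (by positivity)
    _ ↔ 0 < 4 * σ * (σ + c + (1 - σ) * lam) := by
      constructor <;> intro h <;> linarith
    _ ↔ 0 < 1 - α * (1 - lam) := by
      rw [hgap, mul_pos_iff_of_pos_left (by positivity), mul_pos_iff_of_pos_left hn0]
    _ ↔ α < 1 / ((ℓ : ℝ)^2 + ((n : ℝ) - 2) * ℓ - ((n : ℝ) - 2)) := by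
      rw [hden, lt_div_iff₀ (by linarith), sub_pos]
end

section
/- Let n ≥ 2 be an integer and λ ∈ ℝ with λ < -1, and set α = 1/(1-λ). Then α ∈ (0,1/2), c² - 4σ(1-σ)λ ≥ 0, and β⁺(λ) = σ; that is, at the bifurcation exponent α = 1/(1-λ) the linearized translator operator admits the Jacobi field e^(σs)φ for an eigenfunction φ of eigenvalue λ. -/
/-- For an integer `n ≥ 2` and `λ < -1`, setting `α = 1/(1-λ)`,
`σ = (1-2α)/(1+α(n-2))` and `c = ((n-1)-α(n-2))/(1+α(n-2))`, one has
`α ∈ (0,1/2)`, `c² - 4σ(1-σ)λ ≥ 0`, and `β⁺(λ) = σ`: at the bifurcation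
exponent `α = 1/(1-λ)` the linearized translator operator admits the Jacobi
field `e^(σs)φ` for an eigenfunction `φ` of eigenvalue `λ`. -/
theorem stmt10 (n : ℕ) (hn : 2 ≤ n) (lam : ℝ) (hlam : lam < -1)
    (α : ℝ) (hα : α = 1/(1 - lam))
    (σ c : ℝ)
    (hσ : σ = (1 - 2*α) / (1 + α*((n : ℝ) - 2)))
    (hc : c = (((n : ℝ) - 1) - α*((n : ℝ) - 2)) / (1 + α*((n : ℝ) - 2))) :
    (0 < α ∧ α < 1/2) ∧ 0 ≤ c^2 - 4*σ*(1 - σ)*lam ∧ betaP c σ lam = σ := by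
  have hl : 0 < 1 - lam := by linarith
  have hα0 : 0 < α := by rw [hα]; positivity
  have hα1 : α < 1/2 := by
    rw [hα, div_lt_div_iff₀ hl two_pos]; linarith
  have hn' : (0 : ℝ) ≤ (n : ℝ) - 2 := by
    have : (2 : ℝ) ≤ n := by exact_mod_cast hn
    linarith
  have hD : 0 < 1 + α*((n : ℝ) - 2) := by positivity
  have hαlam : α * lam = α - 1 := by
    rw [hα]; field_simp; ring
  have hσ0 : 0 < σ := by
    rw [hσ]; exact div_pos (by linarith) hD
  have hc0 : 0 < c := by
    rw [hc]; exact div_pos (by nlinarith) hD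
  have hroot : σ + c + (1 - σ)*lam = 0 := by
    rw [hσ, hc]
    field_simp
    linear_combination (n : ℝ) * hαlam
  have hdisc : c^2 - 4*σ*(1 - σ)*lam = (2*σ + c)^2 := by
    linear_combination (-4*σ) * hroot
  refine ⟨⟨hα0, hα1⟩, hdisc ▸ sq_nonneg _, ?_⟩
  rw [betaP, hdisc, Real.sqrt_sq (by linarith)]
  ring
end

section
/- Let α ∈ (0,1/2) and let h: ℝ → ℝ be a shrinker support function on the circle. Suppose f: ℝ → ℝ is C^∞ and 2π-periodic, λ ≥ 0 is real, and h(θ)·(f''(θ)+f(θ)) = λ·(h''(θ)+h(θ))·f(θ) for all θ ∈ ℝ. Then there exist real numbers a, b, c such that f(θ) = a·h(θ) + b·cos θ + c·sin θ for all θ. -/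
open Set Filter Topology

/-- A function vanishing at `a` with positive derivative there is negative just before `a` and
positive just after it. -/
lemma HasDerivAt.exists_sign_near_zero {f : ℝ → ℝ} {d a : ℝ} (hf : HasDerivAt f d a)
    (hd : 0 < d) (ha : f a = 0) :
    ∃ ε > 0, (∀ x ∈ Ioo a (a + ε), 0 < f x) ∧ ∀ x ∈ Ioo (a - ε) a, f x < 0 := by
  have hsign := eventually_nhdsWithin_sign_eq_of_deriv_pos (hf.deriv.symm ▸ hd) ha
  obtain ⟨ε, hε, hball⟩ := Metric.eventually_nhds_iff.mp hsign
  refine ⟨ε, hε, fun x hx => ?_, fun x hx => ?_⟩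
  · have := hball (y := x) (by rw [Real.dist_eq, abs_lt]; constructor <;> linarith [hx.1, hx.2])
    rwa [sign_pos (sub_pos.mpr hx.1), sign_eq_one_iff] at this
  · have := hball (y := x) (by rw [Real.dist_eq, abs_lt]; constructor <;> linarith [hx.1, hx.2])
    rwa [sign_neg (sub_neg.mpr hx.2), sign_eq_neg_one_iff] at this

/-- A solution of `f'' = q f` with bounded `q` and vanishing Cauchy data is zero. -/
lemma eq_zero_of_second_order_ode {f f' q : ℝ → ℝ} {K a : ℝ}
    (hf : ∀ x, HasDerivAt f (f' x) x) (hf' : ∀ x, HasDerivAt f' (q x * f x) x)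
    (hq : ∀ x, |q x| ≤ K) (ha : f a = 0) (ha' : f' a = 0) : ∀ x, f x = 0 := by
  have hK : 0 ≤ K := (abs_nonneg _).trans (hq a)
  have hlip : ∀ t, LipschitzOnWith (max 1 K).toNNReal
      (fun p : ℝ × ℝ => (p.2, q t * p.1)) univ := by
    intro t
    refine (LipschitzWith.of_dist_le_mul fun x y => ?_).lipschitzOnWith
    rw [Real.coe_toNNReal _ (by positivity), Prod.dist_eq, Prod.dist_eq]
    simp only [Real.dist_eq]
    have h1 := le_max_left |x.1 - y.1| |x.2 - y.2|
    have h2 := le_max_right |x.1 - y.1| |x.2 - y.2|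
    apply max_le
    · calc |x.2 - y.2| ≤ 1 * max |x.1 - y.1| |x.2 - y.2| := by linarith
        _ ≤ _ := by gcongr; exact le_max_left _ _
    · rw [← mul_sub, abs_mul]
      gcongr
      exact (hq t).trans (le_max_right _ _)
  have heq := ODE_solution_unique_univ (t₀ := a) (f := fun t => (f t, f' t))
    (g := fun _ => (0, 0)) hlip
    (fun t => ⟨(hf t).prodMk (hf' t), mem_univ _⟩)
    (fun t => ⟨(hasDerivAt_const t ((0 : ℝ), (0 : ℝ))).congr_deriv (by ext <;> simp), mem_univ _⟩)
    (by simp [ha, ha'])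
  intro x
  exact congrArg Prod.fst (congrFun heq x)

/-- Sturm comparison with the sine: a solution of `f'' = q f` with `q > -1` that leaves zero
upwards at `a` stays positive on `(a, a + π]`. -/
lemma pos_of_sturm_comparison {f f' q : ℝ → ℝ} {a : ℝ}
    (hf : ∀ x, HasDerivAt f (f' x) x) (hf' : ∀ x, HasDerivAt f' (q x * f x) x)
    (hq : ∀ x, -1 < q x) (ha : f a = 0) (ha' : 0 < f' a) :
    ∀ x ∈ Ioc a (a + Real.pi), 0 < f x := by
  intro x hx
  by_contra! hfx
  have hcont : Continuous f := continuous_iff_continuousAt.mpr fun x => (hf x).continuousAt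
  obtain ⟨ε, hε, hpos, -⟩ := (hf a).exists_sign_near_zero ha' ha
  obtain ⟨b, ⟨hb, hfb⟩, hbmin⟩ :=
    (isCompact_Icc.inter_right (isClosed_Iic.preimage hcont)).exists_isLeast
      (s := Icc (a + ε / 2) x ∩ f ⁻¹' Iic 0) ⟨x, ⟨⟨by
        by_contra! hlt
        exact absurd (hpos x ⟨hx.1, by linarith⟩) hfx.not_gt, le_rfl⟩, hfx⟩⟩
  have hab : a < b := by linarith [hb.1]
  have hbx : b ≤ a + Real.pi := hb.2.trans hx.2
  have hpos' : ∀ y ∈ Ioo a b, 0 < f y := by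
    intro y hy
    by_contra! hfy
    rcases lt_or_ge y (a + ε / 2) with h | h
    · exact absurd (hpos y ⟨hy.1, by linarith⟩) hfy.not_gt
    · exact absurd (hbmin ⟨⟨h, hy.2.le.trans hb.2⟩, hfy⟩) hy.2.not_ge
  have hfb0 : f b = 0 := by
    refine le_antisymm hfb ?_
    refine ge_of_tendsto (hcont.continuousAt.tendsto.mono_left nhdsWithin_le_nhds :
      Tendsto f (𝓝[<] b) (𝓝 (f b))) ?_
    filter_upwards [Ioo_mem_nhdsLT hab] with y hy using (hpos' y hy).le
  have hW : ∀ y, HasDerivAt (fun y => f' y * Real.sin (y - a) - f y * Real.cos (y - a))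
      ((q y + 1) * (f y * Real.sin (y - a))) y := by
    intro y
    have hs := ((hasDerivAt_id y).sub_const a).sin
    have hc := ((hasDerivAt_id y).sub_const a).cos
    refine (((hf' y).mul hs).sub ((hf y).mul hc)).congr_deriv ?_
    simp only [id]
    ring
  have hmono : StrictMonoOn (fun y => f' y * Real.sin (y - a) - f y * Real.cos (y - a))
      (Icc a b) := by
    refine strictMonoOn_of_deriv_pos (convex_Icc a b)
      (fun y _ => (hW y).continuousAt.continuousWithinAt) fun y hy => ?_
    rw [interior_Icc] at hy
    rw [(hW y).deriv]
    exact mul_pos (by linarith [hq y]) (mul_pos (hpos' y hy)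
      (Real.sin_pos_of_pos_of_lt_pi (by linarith [hy.1]) (by linarith [hy.2])))
  have hlt := hmono (left_mem_Icc.mpr hab.le) (right_mem_Icc.mpr hab.le) hab
  simp only [ha, hfb0, sub_self, Real.sin_zero, mul_zero, zero_mul, sub_zero] at hlt
  have hdb : 0 < f' b := pos_of_mul_pos_left hlt
    (Real.sin_nonneg_of_nonneg_of_le_pi (by linarith) (by linarith))
  obtain ⟨δ, hδ, -, hneg⟩ := (hf b).exists_sign_near_zero hdb hfb0
  obtain ⟨y, hy, hyb⟩ := exists_between (max_lt hab (by linarith : b - δ < b))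
  exact absurd (hpos' y ⟨(le_max_left _ _).trans_lt hy, hyb⟩)
    (hneg y ⟨(le_max_right _ _).trans_lt hy, hyb⟩).not_gt

/-- A `2π`-periodic solution of `f'' = q f` with `q > -1` has no upward zero crossing. -/
lemma Function.Periodic.deriv_nonpos_of_sturm {f f' q : ℝ → ℝ} {a : ℝ}
    (hper : Function.Periodic f (2 * Real.pi))
    (hf : ∀ x, HasDerivAt f (f' x) x) (hf' : ∀ x, HasDerivAt f' (q x * f x) x)
    (hq : ∀ x, -1 < q x) (ha : f a = 0) : f' a ≤ 0 := by
  by_contra! ha'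
  have hmem : a + Real.pi ∈ Ioc a (a + Real.pi) := ⟨by linarith [Real.pi_pos], le_rfl⟩
  have hright := pos_of_sturm_comparison hf hf' hq ha ha' _ hmem
  have hrefl : ∀ x : ℝ, HasDerivAt (fun x => 2 * a - x) (-1) x := fun x => by
    simpa using (hasDerivAt_id x).const_sub (2 * a)
  have hleft := pos_of_sturm_comparison (a := a) (f := fun x => -f (2 * a - x))
    (f' := fun x => f' (2 * a - x)) (q := fun x => q (2 * a - x))
    (fun x => ((hf (2 * a - x)).comp x (hrefl x)).neg.congr_deriv (by ring))
    (fun x => ((hf' (2 * a - x)).comp x (hrefl x)).congr_deriv (by ring))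
    (fun x => hq _) (by simp [two_mul, ha]) (by simpa [two_mul] using ha') _ hmem
  have hval := hper (2 * a - (a + Real.pi))
  rw [show 2 * a - (a + Real.pi) + 2 * Real.pi = a + Real.pi by ring] at hval
  linarith

/-- A `2π`-periodic solution of `f'' = q f` with `q > -1` has only degenerate zeros. -/
lemma Function.Periodic.deriv_eq_zero_of_sturm {f f' q : ℝ → ℝ} {a : ℝ}
    (hper : Function.Periodic f (2 * Real.pi))
    (hf : ∀ x, HasDerivAt f (f' x) x) (hf' : ∀ x, HasDerivAt f' (q x * f x) x)
    (hq : ∀ x, -1 < q x) (ha : f a = 0) : f' a = 0 := by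
  refine le_antisymm (hper.deriv_nonpos_of_sturm hf hf' hq ha) ?_
  have hneg := Function.Periodic.deriv_nonpos_of_sturm (a := a) (f := fun x => -f x)
    (f' := fun x => -f' x) (fun x => by simp [hper x]) (fun x => (hf x).neg)
    (fun x => (hf' x).neg.congr_deriv (by ring)) hq (by simp [ha])
  linarith

/-- If `f'' + f = lam w f` and `h'' + h = w h` with `f`, `h` periodic and `h`, `w` positive,
and `f` has no zero, then `f` is a multiple of `h`. -/
lemma exists_eq_mul_of_ne_zero {f f' h h' w : ℝ → ℝ} {T lam : ℝ} (hT : 0 < T)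
    (hper : Function.Periodic h T) (hfper : Function.Periodic f T)
    (hh : ∀ x, HasDerivAt h (h' x) x) (hh' : ∀ x, HasDerivAt h' ((w x - 1) * h x) x)
    (hf : ∀ x, HasDerivAt f (f' x) x) (hf' : ∀ x, HasDerivAt f' ((lam * w x - 1) * f x) x)
    (hw : ∀ x, 0 < w x) (hpos : ∀ x, 0 < h x) (hne : ∀ x, f x ≠ 0) :
    ∃ a : ℝ, ∀ x, f x = a * h x := by
  have hp : ∀ x, HasDerivAt (fun x => f x / h x) ((f' x * h x - f x * h' x) / h x ^ 2) x :=
    fun x => (hf x).div (hh x) (hpos x).ne'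
  have hV : ∀ x, HasDerivAt (fun x => f' x * h x - f x * h' x)
      ((lam - 1) * (w x * f x * h x)) x := fun x =>
    (((hf' x).mul (hh x)).sub ((hf x).mul (hh' x))).congr_deriv (by ring)
  have hzero : ∀ s, ∃ c ∈ Ioo s (s + T), f' c * h c - f c * h' c = 0 := by
    intro s
    obtain ⟨c, hc, hc0⟩ := exists_hasDerivAt_eq_zero (a := s) (b := s + T) (by linarith)
      (fun x _ => (hp x).continuousAt.continuousWithinAt) (by simp [hper s, hfper s])
      fun x _ => hp x
    exact ⟨c, hc, (div_eq_zero_iff.mp hc0).resolve_right (pow_ne_zero _ (hpos c).ne')⟩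
  obtain ⟨c, hc, hc0⟩ := hzero 0
  obtain ⟨d, hd, hd0⟩ := hzero (0 + T)
  obtain ⟨e, -, he⟩ := exists_hasDerivAt_eq_zero (hc.2.trans hd.1)
    (fun x _ => (hV x).continuousAt.continuousWithinAt) (hc0.trans hd0.symm) fun x _ => hV x
  have hlam : lam - 1 = 0 := (mul_eq_zero.mp he).resolve_right
    (mul_ne_zero (mul_ne_zero (hw e).ne' (hne e)) (hpos e).ne')
  have hV0 : ∀ x, f' x * h x - f x * h' x = 0 := fun x =>
    (is_const_of_deriv_eq_zero (fun x => (hV x).differentiableAt)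
      (fun x => by rw [(hV x).deriv, hlam, zero_mul]) x c).trans hc0
  refine ⟨f 0 / h 0, fun x => ?_⟩
  have hconst := is_const_of_deriv_eq_zero (fun x => (hp x).differentiableAt)
    (fun x => by rw [(hp x).deriv, hV0, zero_div]) x 0
  rw [← hconst, div_mul_cancel₀ _ (hpos x).ne']


/-- Let `α ∈ (0,1/2)` and let `h` be a shrinker support function
on the circle (smooth, `2π`-periodic, positive, `h'' + h = h^(1-1/α)`). If `f`
is smooth and `2π`-periodic, `λ ≥ 0`, and
`h (f'' + f) = λ (h'' + h) f` pointwise (i.e. `f` is an eigenfunction of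
`L f = h (f''+f)/(h''+h)` with nonnegative eigenvalue `λ`), then
`f = a h + b cos + c sin` for some reals `a, b, c`. -/
theorem stmt12 (α : ℝ) (hα0 : 0 < α) (hα2 : α < 1/2)
    (h : ℝ → ℝ) (hsm : ContDiff ℝ (⊤ : ℕ∞) h) (hper : Function.Periodic h (2*Real.pi))
    (hpos : ∀ θ, 0 < h θ)
    (hshr : ∀ θ, deriv (deriv h) θ + h θ = h θ ^ (1 - 1/α))
    (f : ℝ → ℝ) (hfsm : ContDiff ℝ (⊤ : ℕ∞) f) (hfper : Function.Periodic f (2*Real.pi))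
    (lam : ℝ) (hlam : 0 ≤ lam)
    (heig : ∀ θ, h θ * (deriv (deriv f) θ + f θ)
      = lam * (deriv (deriv h) θ + h θ) * f θ) :
    ∃ a b c : ℝ, ∀ θ, f θ = a * h θ + b * Real.cos θ + c * Real.sin θ := by
  have hderiv : ∀ g : ℝ → ℝ, ContDiff ℝ (⊤ : ℕ∞) g → (∀ x, HasDerivAt g (deriv g x) x) ∧
      (∀ x, HasDerivAt (deriv g) (deriv (deriv g) x) x) := fun g hg => by
    have h1 : ContDiff ℝ (⊤ : ℕ∞) (deriv g) := (contDiff_infty_iff_deriv.mp hg).2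
    exact ⟨fun x => (hg.differentiable (by simp) x).hasDerivAt,
      fun x => (h1.differentiable (by simp) x).hasDerivAt⟩
  obtain ⟨hh, hh'⟩ := hderiv h hsm
  obtain ⟨hf, hf'⟩ := hderiv f hfsm
  set w : ℝ → ℝ := fun x => h x ^ (1 - 1 / α) / h x with hw_def
  have hwpos : ∀ x, 0 < w x := fun x => div_pos (Real.rpow_pos_of_pos (hpos x) _) (hpos x)
  have hwh : ∀ x, deriv (deriv h) x + h x = w x * h x := fun x => by
    rw [hshr, div_mul_cancel₀ _ (hpos x).ne']
  have hwf : ∀ x, deriv (deriv f) x + f x = lam * w x * f x := fun x => by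
    refine mul_left_cancel₀ (hpos x).ne' ?_
    rw [heig, hwh]
    ring
  have hh'' : ∀ x, HasDerivAt (deriv h) ((w x - 1) * h x) x := fun x =>
    (hh' x).congr_deriv (by linarith [hwh x])
  have hf'' : ∀ x, HasDerivAt (deriv f) ((lam * w x - 1) * f x) x := fun x =>
    (hf' x).congr_deriv (by linarith [hwf x])
  rcases hlam.eq_or_lt with rfl | hlam
  · refine ⟨0, f 0, deriv f 0, fun θ => ?_⟩
    have hzero := eq_zero_of_second_order_ode (a := 0) (q := fun _ => -1) (K := 1)
      (f := fun x => f x - (f 0 * Real.cos x + deriv f 0 * Real.sin x))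
      (f' := fun x => deriv f x - (f 0 * -Real.sin x + deriv f 0 * Real.cos x))
      (fun x => (hf x).sub (((Real.hasDerivAt_cos x).const_mul _).add
        ((Real.hasDerivAt_sin x).const_mul _)))
      (fun x => ((hf'' x).sub (((Real.hasDerivAt_sin x).neg.const_mul (f 0)).add
        ((Real.hasDerivAt_cos x).const_mul (deriv f 0)))).congr_deriv (by ring))
      (by simp) (by simp) (by simp) θ
    linarith
  · by_cases hne : ∀ x, f x ≠ 0
    · obtain ⟨a, ha⟩ := exists_eq_mul_of_ne_zero Real.two_pi_pos hper hfper hh hh'' hf hf''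
        hwpos hpos hne
      exact ⟨a, 0, 0, fun θ => by simp [ha θ]⟩
    · push Not at hne
      obtain ⟨a, ha⟩ := hne
      have hq : ∀ x, -1 < lam * w x - 1 := fun x => by linarith [mul_pos hlam (hwpos x)]
      have hqcont : Continuous fun x => lam * w x - 1 := by
        have hc := hsm.continuous
        have hr := hc.rpow_const (p := 1 - 1 / α) fun x => Or.inl (hpos x).ne'
        exact (continuous_const.mul (hr.div hc fun x => (hpos x).ne')).sub continuous_const
      have hqper : Function.Periodic (fun x => lam * w x - 1) (2 * Real.pi) := fun x => by
        simp only [hw_def, hper x]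
      obtain ⟨K, hK⟩ := isBounded_iff_forall_norm_le.mp
        (hqper.isBounded_of_continuous Real.two_pi_pos.ne' hqcont)
      have hzero := eq_zero_of_second_order_ode hf hf'' (fun x => hK _ (mem_range_self x)) ha
        (hfper.deriv_eq_zero_of_sturm hf hf'' hq ha)
      exact ⟨0, 0, 0, fun θ => by simp [hzero θ]⟩
end
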